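/- arXiv:0910.0605 — 2 statements merged into one kernel-verified Lean document; each statement's English description precedes it below -/
import Mathlib

section
/- Let X be an integral separated scheme and σ : X ≅ X an automorphism of X (as a scheme) such that σ fixes the generic point η and the induced stalk map on the function field O_{X,η} is the identity. Then σ is the identity automorphism of X. -/
open AlgebraicGeometry CategoryTheory

lemma Scheme.specMap_eqToHom_fromSpecStalk (X : AlgebraicGeometry.Scheme) {x y : X} (h : y = x)
    (e : X.presheaf.stalk y = X.presheaf.stalk x) :
    Spec.map (eqToHom e) ≫ X.fromSpecStalk y = X.fromSpecStalk x := by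
  subst h
  simp

lemma Scheme.isDominant_fromSpecStalk_genericPoint (X : AlgebraicGeometry.Scheme)
    [IrreducibleSpace X] : IsDominant (X.fromSpecStalk (genericPoint X)) where
  denseRange := by
    refine Dense.mono ?_ (dense_iff_closure_eq.mpr (genericPoint_closure (α := X)))
    rw [Scheme.range_fromSpecStalk]
    rintro x rfl
    exact specializes_rfl

/-- Let `X` be an integral separated scheme and `σ : X ≅ X` an automorphism of `X` (as a
scheme) fixing the generic point `η` and inducing the identity on the function field
`O_{X,η}` (i.e. its stalk map at `η` is the identity, modulo the identification of stalks
given by `σ(η) = η`).  Then `σ` is the identity automorphism of `X`. -/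
theorem Scheme.iso_eq_refl_of_genericPoint_fixed_of_stalkMap_id
    (X : AlgebraicGeometry.Scheme) [IsIntegral X] [X.IsSeparated]
    (σ : X ≅ X)
    (hη : σ.hom.base (genericPoint X) = genericPoint X)
    (hstalk : σ.hom.stalkMap (genericPoint X) = eqToHom (by rw [hη])) :
    σ = Iso.refl X := by
  have := Scheme.isDominant_fromSpecStalk_genericPoint X
  ext1
  refine ext_of_isDominant (X.fromSpecStalk (genericPoint X)) ?_
  rw [← Scheme.SpecMap_stalkMap_fromSpecStalk, hstalk, Iso.refl_hom, Category.comp_id]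
  exact Scheme.specMap_eqToHom_fromSpecStalk X hη _
end

section
/- Let X be an integral separated scheme with generic point η and function field K = O_{X,η}. For a point x of X, the germ map O_{X,x} → K is injective; regard O_{X,x} as a subring of K via this map. If two points x, y of X satisfy that O_{X,x} and O_{X,y} have the same image in K (i.e., they are equal as subrings of the function field), then x = y. -/
open AlgebraicGeometry CategoryTheory

/-- Let `X` be an integral separated scheme with generic point `η` and function field
`K = O_{X,η}`.  For every point `x` of `X` the germ map `O_{X,x} → K` (the canonical
algebra map to the function field) is injective, and if two points `x, y` of `X` are such
that `O_{X,x}` and `O_{X,y}` have the same image in `K` (i.e. they are equal as subrings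
of the function field), then `x = y`. -/
theorem Scheme.stalk_functionField_injective_and_eq_of_range_eq
    (X : AlgebraicGeometry.Scheme) [IsIntegral X] [X.IsSeparated] :
    (∀ x : X, Function.Injective (algebraMap (X.presheaf.stalk x) X.functionField)) ∧
      (∀ x y : X,
        (algebraMap (X.presheaf.stalk x) X.functionField).range =
          (algebraMap (X.presheaf.stalk y) X.functionField).range → x = y) := by
  have inj (x : X) : Function.Injective (algebraMap (X.presheaf.stalk x) X.functionField) :=
    IsFractionRing.injective _ _
  refine ⟨inj, fun x y h ↦ ?_⟩
  let r (z : X) : X.presheaf.stalk z ≃+* (algebraMap (X.presheaf.stalk z) X.functionField).range :=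
    RingEquiv.ofBijective (algebraMap (X.presheaf.stalk z) X.functionField).rangeRestrict
      ⟨fun _ _ hab ↦ inj z (congrArg Subtype.val hab), RingHom.rangeRestrict_surjective _⟩
  let e : X.presheaf.stalk y ≃+* X.presheaf.stalk x :=
    ((r y).trans (RingEquiv.subringCongr h.symm)).trans (r x).symm
  have he (a : X.presheaf.stalk y) : algebraMap (X.presheaf.stalk x) X.functionField (e a) =
      algebraMap (X.presheaf.stalk y) X.functionField a :=
    congrArg Subtype.val ((r x).apply_symm_apply _)
  let φ : X.presheaf.stalk y ⟶ X.presheaf.stalk x := CommRingCat.ofHom e.toRingHom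
  have hx := (genericPoint_spec X).specializes (Set.mem_univ x)
  have hy := (genericPoint_spec X).specializes (Set.mem_univ y)
  have hφ : φ ≫ X.presheaf.stalkSpecializes hx = X.presheaf.stalkSpecializes hy := by
    ext a
    exact he a
  have : IsDominant (Spec.map (X.presheaf.stalkSpecializes hx)) :=
    ⟨(PrimeSpectrum.denseRange_comap_iff_ker_le_nilRadical _).mpr
      (((RingHom.injective_iff_ker_eq_bot _).mp (inj x)).trans_le bot_le)⟩
  have hfg : X.fromSpecStalk x = Spec.map φ ≫ X.fromSpecStalk y := by
    refine ext_of_isDominant (Spec.map (X.presheaf.stalkSpecializes hx)) ?_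
    rw [← Spec.map_comp_assoc, hφ, Scheme.SpecMap_stalkSpecializes_fromSpecStalk,
      Scheme.SpecMap_stalkSpecializes_fromSpecStalk]
  have : IsLocalHom e.toRingHom := ⟨(isLocalHom_equiv e).map_nonunit⟩
  have hc : Spec.map φ (IsLocalRing.closedPoint (X.presheaf.stalk x)) =
      IsLocalRing.closedPoint (X.presheaf.stalk y) :=
    IsLocalRing.comap_closedPoint e.toRingHom
  calc x = X.fromSpecStalk x (IsLocalRing.closedPoint _) := Scheme.fromSpecStalk_closedPoint.symm
    _ = X.fromSpecStalk y (Spec.map φ (IsLocalRing.closedPoint _)) := by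
      rw [hfg]; rfl
    _ = y := by rw [hc, Scheme.fromSpecStalk_closedPoint]
end
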